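/- Let w be a weight function on the goods [m], let v_1 ≥ v_2 ≥ ... ≥ v_n ≥ 0 be real valuation parameters, and let P = (P_1,...,P_n) be an n-partition of [m] satisfying the EFX condition under w and indexed so that w(P_1) ≥ w(P_2) ≥ ... ≥ w(P_n). Then for every n-partition Q = (Q_1,...,Q_n) of [m] satisfying the EFX condition under w and every bijection σ of {1,...,n}, one has Σ_{i=1}^n v_i · w(P_i) ≥ (1/2) · Σ_{i=1}^n v_i · w(Q_{σ(i)}). -/

import Mathlib

open Finset

/-- Weight of a bundle: sum of the weights of its goods. -/
noncomputable def setW {m : ℕ} (w : Fin m → ℝ) (S : Finset (Fin m)) : ℝ := ∑ g ∈ S, w g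

/-- An `n`-partition of the goods `[m]`: pairwise disjoint parts covering everything. -/
def IsPartition {m n : ℕ} (P : Fin n → Finset (Fin m)) : Prop :=
  (∀ i j, i ≠ j → Disjoint (P i) (P j)) ∧ Finset.univ.biUnion P = Finset.univ

/-- The EFX condition under a common weight function `w`. -/
def EFX {m n : ℕ} (w : Fin m → ℝ) (P : Fin n → Finset (Fin m)) : Prop :=
  ∀ i j, ∀ g ∈ P j, setW w (P i) ≥ setW w (P j) - w g

lemma setW_mono {m : ℕ} {w : Fin m → ℝ} (hw : ∀ g, 0 ≤ w g) {S T : Finset (Fin m)}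
    (h : S ⊆ T) : setW w S ≤ setW w T :=
  sum_le_sum_of_subset_of_nonneg h fun g _ _ => hw g

lemma setW_nonneg {m : ℕ} {w : Fin m → ℝ} (hw : ∀ g, 0 ≤ w g) (S : Finset (Fin m)) :
    0 ≤ setW w S :=
  sum_nonneg fun g _ => hw g

lemma IsPartition.setW_biUnion {m n : ℕ} {P : Fin n → Finset (Fin m)} (hP : IsPartition P)
    (w : Fin m → ℝ) (U : Finset (Fin n)) : setW w (U.biUnion P) = ∑ i ∈ U, setW w (P i) :=
  sum_biUnion fun i _ j _ hij => hP.1 i j hij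

lemma IsPartition.sum_setW {m n : ℕ} {P : Fin n → Finset (Fin m)} (hP : IsPartition P)
    (w : Fin m → ℝ) : ∑ i, setW w (P i) = setW w univ := by
  rw [← hP.setW_biUnion, hP.2]

lemma IsPartition.exists_mem {m n : ℕ} {P : Fin n → Finset (Fin m)} (hP : IsPartition P)
    (g : Fin m) : ∃ i, g ∈ P i := by
  have h : g ∈ univ.biUnion P := hP.2 ▸ mem_univ g
  simpa using h

/-- A bundle of an EFX partition with at least two goods weighs at most twice any bundle. -/
lemma EFX.setW_le_two_mul {m n : ℕ} {w : Fin m → ℝ} (hw : ∀ g, 0 ≤ w g)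
    {Q : Fin n → Finset (Fin m)} (hQ : EFX w Q) {j : Fin n} (hj : 1 < #(Q j)) (i : Fin n) :
    setW w (Q j) ≤ 2 * setW w (Q i) := by
  obtain ⟨g, hg, h, hh, hne⟩ := one_lt_card.mp hj
  have hpair : setW w {g, h} ≤ setW w (Q j) :=
    setW_mono hw (by simp [insert_subset_iff, hg, hh])
  rw [setW, sum_pair hne] at hpair
  linarith [hQ i j g hg, hQ i j h hh]

/-- If the bundles `Q j`, `j ∈ J`, have at most one good each, some family of at most `#J` bundles
of a partition `P` weighs at least as much. -/
lemma IsPartition.exists_cover {m n : ℕ} {w : Fin m → ℝ} (hw : ∀ g, 0 ≤ w g)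
    {P Q : Fin n → Finset (Fin m)} (hP : IsPartition P) (hQ : IsPartition Q)
    (J : Finset (Fin n)) (hJ : ∀ j ∈ J, #(Q j) ≤ 1) :
    ∃ U : Finset (Fin n), #U ≤ #J ∧ ∑ j ∈ J, setW w (Q j) ≤ ∑ i ∈ U, setW w (P i) := by
  have hsub : ∀ j, ∃ i, j ∈ J → Q j ⊆ P i := by
    intro j
    rcases (Q j).eq_empty_or_nonempty with h | ⟨g, hg⟩
    · exact ⟨j, fun _ => by simp [h]⟩
    · obtain ⟨i, hi⟩ := hP.exists_mem g
      refine ⟨i, fun hj x hx => ?_⟩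
      rwa [card_le_one.mp (hJ j hj) x hx g hg]
  choose φ hφ using hsub
  refine ⟨J.image φ, card_image_le, ?_⟩
  rw [← hP.setW_biUnion, ← hQ.setW_biUnion]
  refine setW_mono hw (biUnion_subset.mpr fun j hj => ?_)
  exact (hφ j hj).trans (subset_biUnion_of_mem P (mem_image_of_mem φ hj))

/-- The heaviest bundles of any partition weigh at least half as much as equally many bundles of
an EFX partition. -/
lemma EFX.half_sum_le {m n : ℕ} {w : Fin m → ℝ} (hw : ∀ g, 0 ≤ w g)
    {P Q : Fin n → Finset (Fin m)} (hP : IsPartition P) (hQ : IsPartition Q) (hQefx : EFX w Q)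
    {K T : Finset (Fin n)} (hKT : #K = #T) (k : Fin n)
    (hK : ∀ i ∈ K, setW w (P k) ≤ setW w (P i))
    (hK' : ∀ i ∉ K, setW w (P i) ≤ setW w (P k)) :
    1 / 2 * ∑ j ∈ T, setW w (Q j) ≤ ∑ i ∈ K, setW w (P i) := by
  have : Nonempty (Fin n) := ⟨k⟩
  obtain ⟨j₀, hmin⟩ := Finite.exists_min fun j => setW w (Q j)
  have htotal : ∑ i, setW w (P i) = ∑ j, setW w (Q j) := by rw [hP.sum_setW, hQ.sum_setW]
  have ha := setW_nonneg hw (Q j₀)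
  have hc := setW_nonneg hw (P k)
  set a := setW w (Q j₀)
  set c := setW w (P k)
  set J := {j ∈ T | 2 * a < setW w (Q j)} with hJ
  have hJT : J ⊆ T := filter_subset _ _
  obtain ⟨U, hUJ, hU⟩ := hP.exists_cover hw hQ J fun j hj => by
    by_contra! h
    exact (mem_filter.mp hj).2.not_ge (hQefx.setW_le_two_mul hw h j₀)
  have hJ0 : 0 ≤ ∑ j ∈ J, setW w (Q j) := sum_nonneg fun j _ => setW_nonneg hw _
  have hT : ∑ j ∈ T, setW w (Q j) ≤ ∑ j ∈ J, setW w (Q j) + (#T - #J) * (2 * a) := by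
    rw [← sum_sdiff hJT, add_comm, ← Nat.cast_sub (card_le_card hJT), ← card_sdiff_of_subset hJT,
      ← nsmul_eq_mul]
    gcongr
    refine sum_le_card_nsmul _ _ _ fun j hj => ?_
    simp only [hJ, mem_sdiff, mem_filter, not_and, not_lt] at hj
    exact hj.2 hj.1
  suffices h : ∑ j ∈ J, setW w (Q j) + (#T - #J) * a ≤ ∑ i ∈ K, setW w (P i) by linarith
  have hUJ' : (#U : ℝ) ≤ #J := by exact_mod_cast hUJ
  have hJT' : (#J : ℝ) ≤ #T := by exact_mod_cast card_le_card hJT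
  have hKT' : (#K : ℝ) = #T := by exact_mod_cast hKT
  rcases le_total a c with hac | hca
  · have hUK : ∑ i ∈ U, (setW w (P i) - c) ≤ ∑ i ∈ K, (setW w (P i) - c) := by
      rw [← sum_inter_add_sum_sdiff U K, ← sum_inter_add_sum_sdiff K U, inter_comm K U]
      have hout : ∑ i ∈ U \ K, (setW w (P i) - c) ≤ 0 :=
        sum_nonpos fun i hi => sub_nonpos.mpr (hK' i (mem_sdiff.mp hi).2)
      have hin : 0 ≤ ∑ i ∈ K \ U, (setW w (P i) - c) :=
        sum_nonneg fun i hi => sub_nonneg.mpr (hK i (mem_sdiff.mp hi).1)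
      linarith
    simp only [sum_sub_distrib, sum_const, nsmul_eq_mul] at hUK
    nlinarith
  · have hPK : ∑ i ∈ Kᶜ, setW w (P i) ≤ (n - #K) * c := by
      have := sum_le_card_nsmul Kᶜ (fun i => setW w (P i)) c fun i hi => hK' i (by simpa using hi)
      rwa [nsmul_eq_mul, card_compl, Fintype.card_fin, Nat.cast_sub (card_finset_fin_le K)] at this
    have hQJ : (n - #J) * a ≤ ∑ j ∈ Jᶜ, setW w (Q j) := by
      have := card_nsmul_le_sum Jᶜ (fun j => setW w (Q j)) a fun j _ => hmin j
      rwa [nsmul_eq_mul, card_compl, Fintype.card_fin, Nat.cast_sub (card_finset_fin_le J)] at this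
    have hKn : (#K : ℝ) ≤ n := by exact_mod_cast card_finset_fin_le K
    rw [← sum_add_sum_compl K, ← sum_add_sum_compl J] at htotal
    nlinarith [mul_le_mul_of_nonneg_left hca (sub_nonneg.mpr hKn)]

/-- Abel summation: nonnegative prefix sums remain nonnegative under nonnegative antitone
weights. -/
lemma sum_mul_nonneg_of_antitone {n : ℕ} {v x : Fin n → ℝ} (hv : Antitone v)
    (hv0 : ∀ i, 0 ≤ v i) (hx : ∀ k, 0 ≤ ∑ i ∈ Iic k, x i) : 0 ≤ ∑ i, v i * x i := by
  induction n with
  | zero => simp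
  | succ n ih =>
    have hlast : 0 ≤ ∑ i, x i := by
      simpa [← Fin.top_eq_last] using hx (Fin.last n)
    have hinit : 0 ≤ ∑ i : Fin n, (v i.castSucc - v (Fin.last n)) * x i.castSucc := by
      refine ih (fun i j hij => ?_) (fun i => ?_) fun k => ?_
      · exact sub_le_sub_right (hv (Fin.castSucc_le_castSucc_iff.mpr hij)) _
      · exact sub_nonneg.mpr (hv (Fin.le_last _))
      · have := hx k.castSucc
        rwa [← Fin.map_castSuccEmb_Iic, sum_map] at this
    have hsplit : ∑ i, v i * x i = ∑ i : Fin n, (v i.castSucc - v (Fin.last n)) * x i.castSucc +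
        v (Fin.last n) * ∑ i, x i := by
      simp only [Fin.sum_univ_castSucc, sub_mul, sum_sub_distrib, mul_add, mul_sum]
      ring
    rw [hsplit]
    exact add_nonneg hinit (mul_nonneg (hv0 _) hlast)

/-- the sorted allocation of any EFX partition achieves social welfare
at least half that of any EFX allocation. -/
theorem stmt3 {m n : ℕ} (w : Fin m → ℝ) (hw : ∀ g, 0 ≤ w g)
    (v : Fin n → ℝ) (hv : Antitone v) (hv0 : ∀ i, 0 ≤ v i)
    (P : Fin n → Finset (Fin m)) (hP : IsPartition P) (hPefx : EFX w P)
    (hPsorted : Antitone (fun i => setW w (P i))) :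
    ∀ Q : Fin n → Finset (Fin m), IsPartition Q → EFX w Q →
      ∀ σ : Equiv.Perm (Fin n),
        ∑ i, v i * setW w (P i) ≥ (1 / 2) * ∑ i, v i * setW w (Q (σ i)) := by
  intro Q hQ hQefx σ
  have h : 0 ≤ ∑ i, v i * (setW w (P i) - 1 / 2 * setW w (Q (σ i))) := by
    refine sum_mul_nonneg_of_antitone hv hv0 fun k => ?_
    have hk := hQefx.half_sum_le hw hP hQ (K := Iic k) (T := (Iic k).map σ.toEmbedding)
      (card_map _).symm k (fun i hi => hPsorted (mem_Iic.mp hi))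
      (fun i hi => hPsorted (by simpa using (not_le.mp (mt mem_Iic.mpr hi)).le))
    rw [sum_map] at hk
    rw [sum_sub_distrib, ← mul_sum]
    exact sub_nonneg.mpr hk
  rw [ge_iff_le, ← sub_nonneg, mul_sum, ← sum_sub_distrib]
  refine h.trans_eq (sum_congr rfl fun i _ => ?_)
  ring
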